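/- Let ℓ be an imaginary quadratic number field with nontrivial ℚ-automorphism σ, let n ≥ 3, and let h : ℓ^n × ℓ^n → ℓ be a hermitian form: h is additive in each variable, h(c·v, w) = c·h(v, w) and h(v, c·w) = σ(c)·h(v, w) for all c ∈ ℓ, and h(w, v) = σ(h(v, w)) for all v, w. Suppose h is indefinite, i.e., there exist v, w ∈ ℓ^n such that h(v, v) is the image of a positive rational number and h(w, w) is the image of a negative rational number. Then h is isotropic: there exists u ∈ ℓ^n with u ≠ 0 and h(u, u) = 0. -/

import Mathlib

/-- `c` is a value of the norm form of the quaternion algebra `(a, b)` over `ℚ`. -/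
def QSym (a b c : ℚ) : Prop :=
  ∃ x y z w : ℚ, x ^ 2 - a * y ^ 2 - b * z ^ 2 + a * b * w ^ 2 = c

namespace QSym

theorem swap12 {a b c : ℚ} (h : QSym a b c) : QSym b a c := by
  obtain ⟨x, y, z, w, h⟩ := h
  exact ⟨x, z, y, w, by rw [← h]; ring⟩

theorem swap23 {a b c : ℚ} (ha : a ≠ 0) (hc : c ≠ 0) (h : QSym a b c) : QSym a c b := by
  obtain ⟨x, y, z, w, h⟩ := h
  by_cases hN : z ^ 2 - a * w ^ 2 = 0
  · by_cases hw : w = 0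
    · have hz : z = 0 := by simpa [hw] using hN
      subst hw hz
      have h : x ^ 2 - a * y ^ 2 = c := by rw [← h]; ring
      refine ⟨(b + 1) / 2, 0, (b - 1) / 2 * x / c, (b - 1) / 2 * y / c, ?_⟩
      have : ((b + 1) / 2) ^ 2 - a * 0 ^ 2 - c * ((b - 1) / 2 * x / c) ^ 2 +
          a * c * ((b - 1) / 2 * y / c) ^ 2 =
          ((b + 1) / 2) ^ 2 - ((b - 1) / 2) ^ 2 * (x ^ 2 - a * y ^ 2) / c := by
        field_simp; ring
      rw [this, h]; field_simp; ring
    · have hz : z ≠ 0 := by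
        rintro rfl
        apply hN.not_gt.elim
        exact absurd hN (by simp [ha, hw])
      have e : a = (z / w) ^ 2 := by field_simp; linarith
      refine ⟨(b + 1) / 2, (b - 1) / 2 * (w / z), 0, 0, ?_⟩
      rw [e]; field_simp; ring
  · have hb : b = (x ^ 2 - a * y ^ 2 - c) / (z ^ 2 - a * w ^ 2) := by
      field_simp; linarith
    refine ⟨(x * z - a * y * w) / (z ^ 2 - a * w ^ 2), (y * z - x * w) / (z ^ 2 - a * w ^ 2),
      z / (z ^ 2 - a * w ^ 2), w / (z ^ 2 - a * w ^ 2), ?_⟩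
    rw [hb]; field_simp; ring

theorem swap13 {a b c : ℚ} (hb : b ≠ 0) (hc : c ≠ 0) (h : QSym a b c) : QSym c b a :=
  (h.swap12.swap23 hb hc).swap12

theorem mul3 {a b c c' : ℚ} (h : QSym a b c) (h' : QSym a b c') : QSym a b (c * c') := by
  obtain ⟨x, y, z, w, rfl⟩ := h
  obtain ⟨x', y', z', w', rfl⟩ := h'
  refine ⟨x * x' + a * y * y' + b * z * z' - a * b * w * w',
    x * y' + y * x' - b * z * w' + b * w * z',
    x * z' + z * x' + a * y * w' - a * w * y',
    x * w' + w * x' + y * z' - z * y', ?_⟩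
  ring

theorem sq3 {a b : ℚ} (c : ℚ) : QSym a b (c ^ 2) := ⟨c, 0, 0, 0, by ring⟩

theorem cancel3 {a b c t : ℚ} (ht : t ≠ 0) (h : QSym a b (c * t ^ 2)) : QSym a b c := by
  have := h.mul3 (sq3 (a := a) (b := b) t⁻¹)
  have e : c * t ^ 2 * t⁻¹ ^ 2 = c := by field_simp
  rwa [e] at this

theorem div3 {a b c c' : ℚ} (hc : c ≠ 0) (h : QSym a b c) (h' : QSym a b (c * c')) :
    QSym a b c' := by
  apply cancel3 hc
  have := h.mul3 h'
  convert this using 1; ring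

theorem mul1 {a a' b c : ℚ} (ha : a ≠ 0) (ha' : a' ≠ 0) (hb : b ≠ 0) (hc : c ≠ 0)
    (h : QSym a b c) (h' : QSym a' b c) : QSym (a * a') b c :=
  ((h.swap13 hb hc).mul3 (h'.swap13 hb hc)).swap13 hb (mul_ne_zero ha ha')

theorem mul2 {a b b' c : ℚ} (hb : b ≠ 0) (hb' : b' ≠ 0) (ha : a ≠ 0) (hc : c ≠ 0)
    (h : QSym a b c) (h' : QSym a b' c) : QSym a (b * b') c :=
  (mul1 hb hb' ha hc h.swap12 h'.swap12).swap12

theorem div1 {a a' b c : ℚ} (ha : a ≠ 0) (ha' : a' ≠ 0) (hb : b ≠ 0) (hc : c ≠ 0)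
    (h : QSym a b c) (h' : QSym (a * a') b c) : QSym a' b c :=
  (div3 ha (h.swap13 hb hc) (h'.swap13 hb hc)).swap13 hb ha'

theorem neg2 {a c : ℚ} (ha : a ≠ 0) : QSym a (-a) c :=
  ⟨(c + 1) / 2, 0, 0, (c - 1) / (2 * a), by field_simp; ring⟩

/-- Steinberg relation. -/
theorem steinberg {a c : ℚ} (ha : a ≠ 0) (h1 : 1 - a ≠ 0) : QSym a (1 - a) c :=
  swap23 ha h1 ⟨1, 1, 0, 0, by ring⟩

end QSym

/-- Nonzero integers all of whose prime factors are `< n`. -/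
def SmoothInt (n : ℕ) (a : ℤ) : Prop := a ≠ 0 ∧ ∀ p : ℕ, p.Prime → (p : ℤ) ∣ a → p < n

theorem SmoothInt.of_lt {n : ℕ} {a : ℤ} (h0 : a ≠ 0) (h : |a| < n) : SmoothInt n a := by
  refine ⟨h0, fun p _ hd => ?_⟩
  have := Int.le_of_dvd (abs_pos.mpr h0) ((dvd_abs _ _).mpr hd)
  omega

theorem SmoothInt.mul {n : ℕ} {a b : ℤ} (ha : SmoothInt n a) (hb : SmoothInt n b) :
    SmoothInt n (a * b) := by
  refine ⟨mul_ne_zero ha.1 hb.1, fun p hp hd => ?_⟩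
  rcases (Nat.prime_iff_prime_int.mp hp).dvd_or_dvd hd with h | h
  · exact ha.2 p hp h
  · exact hb.2 p hp h

theorem SmoothInt.neg {n : ℕ} {a : ℤ} (ha : SmoothInt n a) : SmoothInt n (-a) :=
  ⟨neg_ne_zero.mpr ha.1, fun p hp hd => ha.2 p hp ((dvd_neg).mp hd)⟩

theorem SmoothInt.prime {n q : ℕ} (hq : q.Prime) (h : q < n) : SmoothInt n q := by
  apply SmoothInt.of_lt
  · exact_mod_cast hq.ne_zero
  · simpa using h

theorem smooth_pos {n : ℕ} {H : ℤ → Prop} (h1 : H 1)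
    (hm : ∀ a b, a ≠ 0 → b ≠ 0 → H a → H b → H (a * b))
    (hp : ∀ p : ℕ, p.Prime → p < n → H p) (a : ℤ) (ha : SmoothInt n a) (h0 : 0 < a) : H a := by
  lift a to ℕ using h0.le
  induction a using induction_on_primes with
  | zero => exact absurd h0 (by simp)
  | one => exact_mod_cast h1
  | prime_mul p a hpp ih =>
    have hp0 := hpp.ne_zero
    have ha0 : a ≠ 0 := by rintro rfl; simp at h0
    push_cast
    apply hm
    · exact_mod_cast hp0
    · exact_mod_cast ha0
    · exact hp p hpp (ha.2 p hpp (by push_cast; exact dvd_mul_right _ _))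
    · apply ih
      · refine ⟨by exact_mod_cast ha0, fun q hq hd => ha.2 q hq ?_⟩
        push_cast; exact hd.mul_left _
      · exact_mod_cast Nat.pos_of_ne_zero ha0

theorem smooth_all {n : ℕ} {H : ℤ → Prop} (h1 : H 1)
    (hm : ∀ a b, a ≠ 0 → b ≠ 0 → H a → H b → H (a * b))
    (hp : ∀ p : ℕ, p.Prime → p < n → H p) (hn : H (-1)) (a : ℤ) (ha : SmoothInt n a) : H a := by
  rcases lt_or_gt_of_ne ha.1 with h | h
  · have := hm (-1) (-a) (by simp) (by simpa using ha.1) hn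
      (smooth_pos h1 hm hp (-a) ha.neg (by omega))
    simpa using this
  · exact smooth_pos h1 hm hp a ha h

/-- Generators: `-1` and the primes `< n`. -/
def GenInt (n : ℕ) (a : ℤ) : Prop := a = -1 ∨ ∃ q : ℕ, q.Prime ∧ q < n ∧ a = q

theorem smooth_gen {n : ℕ} {H : ℤ → Prop} (h1 : H 1)
    (hm : ∀ a b, a ≠ 0 → b ≠ 0 → H a → H b → H (a * b)) {s : Prop}
    (hp : ∀ a, GenInt n a → (0 < a ∨ s) → H a) (a : ℤ) (ha : SmoothInt n a)
    (h0 : 0 < a ∨ s) : H a := by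
  have hp' : ∀ p : ℕ, p.Prime → p < n → H p := fun p h h' =>
    hp p (Or.inr ⟨p, h, h', rfl⟩) (Or.inl (by exact_mod_cast h.pos))
  rcases h0 with h0 | h0
  · exact smooth_pos h1 hm hp' a ha h0
  · exact smooth_all h1 hm hp' (hp _ (Or.inl rfl) (Or.inr h0)) a ha

theorem GenInt.ne {n : ℕ} {a : ℤ} (h : GenInt n a) : a ≠ 0 := by
  rcases h with rfl | ⟨q, hq, -, rfl⟩
  · simp
  · exact_mod_cast hq.ne_zero

theorem GenInt.smooth {n : ℕ} {a : ℤ} (hn : 2 ≤ n) (h : GenInt n a) : SmoothInt n a := by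
  rcases h with rfl | ⟨q, hq, h, rfl⟩
  · exact SmoothInt.of_lt (by simp) (by simp; omega)
  · exact SmoothInt.prime hq h

/-- All smooth symbols of level `n` that are not all negative are trivial. -/
def QLevel (n : ℕ) : Prop := ∀ a b c : ℤ, SmoothInt n a → SmoothInt n b → SmoothInt n c →
  (0 < a ∨ 0 < b ∨ 0 < c) → QSym a b c

theorem qlevel_of_gen {n : ℕ} (h : ∀ a b c : ℤ, GenInt n a → GenInt n b → GenInt n c →
    (0 < a ∨ 0 < b ∨ 0 < c) → QSym a b c) : QLevel n := by
  have c0 : ∀ {x : ℤ}, x ≠ 0 → (x : ℚ) ≠ 0 := fun hx => by exact_mod_cast hx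
  have s1 : ∀ a b c : ℤ, GenInt n a → GenInt n b → SmoothInt n c →
      (0 < c ∨ (0 < a ∨ 0 < b)) → QSym a b c := by
    intro a b c ha hb hc h0
    refine smooth_gen (H := fun c : ℤ => QSym a b c) ?_ ?_ ?_ c hc h0
    · simpa using QSym.sq3 (a := a) (b := b) 1
    · intro x y _ _ hx hy
      push_cast; exact hx.mul3 hy
    · intro x hx hh
      exact h a b x ha hb hx (by tauto)
  have s2 : ∀ a b c : ℤ, GenInt n a → SmoothInt n b → SmoothInt n c →
      (0 < b ∨ (0 < a ∨ 0 < c)) → QSym a b c := by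
    intro a b c ha hb hc h0
    refine smooth_gen (H := fun b : ℤ => QSym a b c) ?_ ?_ ?_ b hb h0
    · exact QSym.swap23 (c0 ha.ne) (by simp) (by simpa using QSym.sq3 (a := a) (b := c) 1)
    · intro x y h0 h0' hx hy
      push_cast; exact QSym.mul2 (c0 h0) (c0 h0') (c0 ha.ne) (c0 hc.1) hx hy
    · intro x hx hh
      exact s1 a x c ha hx hc (by tauto)
  intro a b c ha hb hc h0
  refine smooth_gen (H := fun a : ℤ => QSym a b c) ?_ ?_ ?_ a ha h0
  · exact QSym.swap13 (c0 hb.1) (by simp) (by simpa using QSym.sq3 (a := c) (b := b) 1)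
  · intro x y h0 h0' hx hy
    push_cast; exact QSym.mul1 (c0 h0) (c0 h0') (c0 hb.1) (c0 hc.1) hx hy
  · intro x hx hh
    exact s2 x b c hx hb hc (by tauto)

/-- Tate's congruence step. -/
theorem tate_step {p : ℕ} (hp : p.Prime) (hL : QLevel p) {u w k b : ℤ} (hu : SmoothInt p u)
    (hw : SmoothInt p w) (hk : SmoothInt p k) (hb : SmoothInt p b) (hb0 : 0 < b)
    (e : u - w = p * k) (h : QSym u b p) : QSym w b p := by
  have c0 : ∀ {x : ℤ}, x ≠ 0 → (x : ℚ) ≠ 0 := fun hx => by exact_mod_cast hx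
  have hp0 : (p : ℚ) ≠ 0 := by exact_mod_cast hp.ne_zero
  have e' : (u : ℚ) - w = p * k := by exact_mod_cast e
  have h1 : QSym (u * w : ℤ) b ((-k * w : ℤ) * p) := by
    refine ⟨w, 1, 0, 0, ?_⟩
    push_cast
    linear_combination (-(w : ℚ)) * e'
  have h2 : QSym (u * w : ℤ) b (-k * w : ℤ) :=
    hL _ _ _ (hu.mul hw) hb (hk.neg.mul hw) (by tauto)
  have h3 : QSym (u * w : ℤ) b p := h2.div3 (c0 (hk.neg.mul hw).1) h1
  push_cast at h3
  exact QSym.div1 (c0 hu.1) (c0 hw.1) (c0 hb.1) hp0 h h3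

theorem zmod_two_square : ∀ x : ZMod 2, IsSquare x := by decide

theorem core_zmod {p : ℕ} [hp : Fact p.Prime] (hL : QLevel p) (x y : ZMod p) (hx : x ≠ 0)
    (hy : y ≠ 0) : QSym (x.val : ℤ) (y.val : ℤ) p := by
  have hp0 : (p : ℚ) ≠ 0 := by exact_mod_cast hp.out.ne_zero
  have v0 : ∀ {x : ZMod p}, x ≠ 0 → 0 < x.val := fun hx =>
    Nat.pos_of_ne_zero (by simpa [ZMod.val_eq_zero] using hx)
  have q0 : ∀ {x : ZMod p}, x ≠ 0 → (((x.val : ℤ)) : ℚ) ≠ 0 := fun hx => by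
    have := v0 hx
    simp only [Int.cast_natCast]
    exact_mod_cast this.ne'
  have sm : ∀ {x : ZMod p}, x ≠ 0 → SmoothInt p x.val := fun {x} hx => by
    have := v0 hx
    have := x.val_lt
    exact SmoothInt.of_lt (by omega) (by rw [abs_of_nonneg (by omega)]; omega)
  have red : ∀ x x' y : ZMod p, x ≠ 0 → x' ≠ 0 → y ≠ 0 →
      (QSym ((x.val : ℤ) * (x'.val : ℤ) : ℤ) (y.val : ℤ) p ↔
        QSym ((x * x').val : ℤ) (y.val : ℤ) p) := by
    intro x x' y hx hx' hy
    have hm := ZMod.val_mul x x'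
    have hdm := Nat.div_add_mod (x.val * x'.val) p
    rw [← hm] at hdm
    set k := x.val * x'.val / p with hk
    have hxl := x.val_lt
    have hxl' := x'.val_lt
    have hkp : k < p := by
      rw [hk, Nat.div_lt_iff_lt_mul hp.out.pos]
      exact Nat.mul_lt_mul'' hxl hxl'
    clear_value k
    clear hk
    have hdm' : (x.val : ℤ) * x'.val = p * k + (x * x').val := by exact_mod_cast hdm.symm
    by_cases hk0 : k = 0
    · rw [hdm', hk0]; simp
    · have sk : SmoothInt p (k : ℤ) :=
        SmoothInt.of_lt (by omega) (by rw [abs_of_nonneg (by omega)]; omega)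
      have hy0 : (0 : ℤ) < y.val := by exact_mod_cast v0 hy
      constructor
      · exact tate_step hp.out hL ((sm hx).mul (sm hx')) (sm (mul_ne_zero hx hx')) sk (sm hy) hy0
          (by rw [hdm']; ring)
      · exact tate_step hp.out hL (sm (mul_ne_zero hx hx')) ((sm hx).mul (sm hx')) sk.neg (sm hy)
          hy0 (by rw [hdm']; ring)
  have gsq : ∀ s y : ZMod p, s ≠ 0 → y ≠ 0 → QSym ((s * s).val : ℤ) (y.val : ℤ) p := by
    intro s y hs hy
    rw [← red s s y hs hs hy]
    refine QSym.swap13 (q0 hy) (by push_cast; exact mul_ne_zero (q0 hs) (q0 hs)) ?_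
    have := QSym.sq3 (a := p) (b := (y.val : ℤ)) ((s.val : ℤ) : ℚ)
    convert this using 1
    push_cast; ring
  have strip : ∀ x s y : ZMod p, x ≠ 0 → s ≠ 0 → y ≠ 0 →
      QSym ((s * s * x).val : ℤ) (y.val : ℤ) p → QSym (x.val : ℤ) (y.val : ℤ) p := by
    intro x s y hx hs hy h
    rw [← red _ _ _ (mul_ne_zero hs hs) hx hy] at h
    push_cast only [Int.cast_mul] at h
    exact QSym.div1 (q0 (mul_ne_zero hs hs)) (q0 hx) (q0 hy) hp0 (gsq s y hs hy) (by simpa using h)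
  by_cases hxs : IsSquare x
  · obtain ⟨s, rfl⟩ := hxs
    exact gsq s y (by rintro rfl; simp at hx) hy
  by_cases hys : IsSquare y
  · obtain ⟨s, rfl⟩ := hys
    exact (gsq s x (by rintro rfl; simp at hy) hx).swap12
  have hp2 : p ≠ 2 := by
    rintro rfl
    exact hxs (zmod_two_square x)
  obtain ⟨s, t, hst⟩ : ∃ s t : ZMod p, s * s * x + t * t * y = 1 := by
    obtain ⟨s, t, h⟩ := FiniteField.exists_root_sum_quadratic (R := ZMod p)
      (f := Polynomial.C x * Polynomial.X ^ 2) (g := Polynomial.C y * Polynomial.X ^ 2 - Polynomial.C 1)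
      (by rw [Polynomial.degree_C_mul_X_pow _ hx]; rfl)
      (by
        rw [Polynomial.degree_sub_C, Polynomial.degree_C_mul_X_pow _ hy]
        · rfl
        · rw [Polynomial.degree_C_mul_X_pow _ hy]; decide)
      (by rw [ZMod.card]; exact (hp.out.eq_two_or_odd).resolve_left hp2)
    refine ⟨s, t, ?_⟩
    simp at h
    linear_combination h
  have hs : s ≠ 0 := by
    rintro rfl
    have ht : t ≠ 0 := by rintro rfl; simp at hst
    exact hys ⟨t⁻¹, by field_simp; linear_combination hst⟩
  have ht : t ≠ 0 := by
    rintro rfl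
    exact hxs ⟨s⁻¹, by field_simp; linear_combination hst⟩
  have hg0 : s * s * x ≠ 0 := mul_ne_zero (mul_ne_zero hs hs) hx
  have hh0 : t * t * y ≠ 0 := mul_ne_zero (mul_ne_zero ht ht) hy
  suffices hS : QSym ((s * s * x).val : ℤ) ((t * t * y).val : ℤ) p by
    have h1 := strip x s _ hx hs hh0 hS
    exact (strip y t x hy ht hx h1.swap12).swap12
  generalize s * s * x = g at *
  generalize t * t * y = k at *
  have hsum : g.val + k.val = p + 1 := by
    have h1 : ((g.val + k.val : ℕ) : ZMod p) = ((p + 1 : ℕ) : ZMod p) := by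
      push_cast; simp [hst]
    have h2 := (ZMod.natCast_eq_natCast_iff _ _ _).mp h1
    have hg := v0 hg0
    have hk := v0 hh0
    have hgl := g.val_lt
    have hkl := k.val_lt
    have h3 := (Nat.modEq_iff_dvd.mp h2)
    obtain ⟨c, hc⟩ := h3
    push_cast at hc
    have : c = 0 := by
      have c1 : c < 1 := by by_contra hcc; nlinarith
      have c2 : -1 < c := by by_contra hcc; nlinarith
      omega
    subst this
    omega
  have hgl := g.val_lt
  have hkl := k.val_lt
  have hw : SmoothInt p (1 - (g.val : ℤ)) :=
    SmoothInt.of_lt (by omega) (by rw [abs_lt]; omega)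
  have hst' : QSym (1 - (g.val : ℤ) : ℤ) (g.val : ℤ) p := by
    push_cast
    refine (QSym.steinberg (by exact_mod_cast (v0 hg0).ne') ?_).swap12
    have := hw.1
    exact_mod_cast this
  refine QSym.swap12 (tate_step hp.out hL (u := 1 - (g.val : ℤ)) (k := -1) hw (sm hh0) ?_ (sm hg0)
    (by exact_mod_cast v0 hg0) ?_ hst')
  · exact SmoothInt.of_lt (by simp) (by simpa using hp.out.one_lt)
  · omega

theorem core_gen {p : ℕ} (hp : p.Prime) (hL : QLevel p) (a b : ℤ) (ha : GenInt p a)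
    (hb : GenInt p b) : QSym a b p := by
  have : Fact p.Prime := ⟨hp⟩
  have nat : ∀ u v : ℕ, 0 < u → u < p → 0 < v → v < p → QSym (u : ℤ) (v : ℤ) p := by
    intro u v hu hup hv hvp
    have := core_zmod hL (u : ZMod p) (v : ZMod p)
      (by rw [Ne, ZMod.natCast_eq_zero_iff]; exact Nat.not_dvd_of_pos_of_lt hu hup)
      (by rw [Ne, ZMod.natCast_eq_zero_iff]; exact Nat.not_dvd_of_pos_of_lt hv hvp)
    rwa [ZMod.val_natCast_of_lt hup, ZMod.val_natCast_of_lt hvp] at this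
  have neg : ∀ q : ℕ, q.Prime → q < p → QSym (-1 : ℤ) (q : ℤ) p := by
    intro q hq hqp
    have h1 := nat (p - 1) q (by have := hp.two_le; omega) (by have := hp.two_le; omega) hq.pos hqp
    have h2 := hp.two_le
    refine tate_step hp hL (k := 1) (SmoothInt.of_lt ?_ ?_) (SmoothInt.of_lt ?_ ?_)
      (SmoothInt.of_lt ?_ ?_) (SmoothInt.prime hq hqp) (by exact_mod_cast hq.pos) ?_ h1
    · omega
    · rw [abs_lt]; omega
    · omega
    · rw [abs_lt]; omega
    · omega
    · rw [abs_lt]; omega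
    · omega
  rcases ha with rfl | ⟨q, hq, hqp, rfl⟩ <;> rcases hb with rfl | ⟨r, hr, hrp, rfl⟩
  · obtain ⟨x, y, z, w, h⟩ := Nat.sum_four_squares p
    refine ⟨x, y, z, w, ?_⟩
    have : (p : ℚ) = x ^ 2 + y ^ 2 + z ^ 2 + w ^ 2 := by exact_mod_cast h.symm
    rw [this]; push_cast; ring
  · exact neg r hr hrp
  · exact (neg q hq hqp).swap12
  · exact nat q r hq.pos hqp hr.pos hrp

theorem qlevel_succ {p : ℕ} (hL : QLevel p) : QLevel (p + 1) := by
  by_cases hp : p.Prime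
  · have hp0 : (p : ℚ) ≠ 0 := by exact_mod_cast hp.ne_zero
    have c0 : ∀ {x : ℤ}, x ≠ 0 → (x : ℚ) ≠ 0 := fun hx => by exact_mod_cast hx
    have spl : ∀ a, GenInt (p + 1) a → GenInt p a ∨ a = p := by
      rintro a (h | ⟨q, hq, h, rfl⟩)
      · exact Or.inl (Or.inl h)
      · rcases Nat.lt_succ_iff_lt_or_eq.mp h with h | rfl
        · exact Or.inl (Or.inr ⟨q, hq, h, rfl⟩)
        · exact Or.inr rfl
    have m1 : GenInt p (-1) := Or.inl rfl
    have pp : ∀ b : ℤ, b ≠ 0 → QSym b (-1 : ℤ) p → QSym b p p := by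
      intro b hb h
      have h1 : QSym p b (-p) := (QSym.neg2 hp0).swap23 hp0 (c0 hb)
      have h2 : QSym p b (-1) := by
        have := (h.swap23 (c0 hb) hp0).swap12
        simpa using this
      have := (h1.mul3 h2).swap12
      refine (QSym.swap23 (c0 hb) hp0 ?_)
      simpa using this
    have last : ∀ a b : ℤ, GenInt (p + 1) a → GenInt (p + 1) b → QSym a b p := by
      intro a b ha hb
      rcases spl a ha with ha' | rfl
      · rcases spl b hb with hb' | rfl
        · exact core_gen hp hL a b ha' hb'
        · exact pp a ha.ne (core_gen hp hL _ _ ha' m1)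
      · refine QSym.swap12 (pp b hb.ne ?_)
        rcases spl b hb with hb' | rfl
        · exact core_gen hp hL _ _ hb' m1
        · exact QSym.swap12 (pp _ (by simp) (core_gen hp hL _ _ m1 m1))
    apply qlevel_of_gen
    intro a b c ha hb hc h0
    rcases spl c hc with hc' | rfl
    · rcases spl b hb with hb' | rfl
      · rcases spl a ha with ha' | rfl
        · exact hL a b c (ha'.smooth hp.two_le) (hb'.smooth hp.two_le) (hc'.smooth hp.two_le) h0
        · exact QSym.swap13 (c0 hb.ne) hp0 (last c b hc hb)
      · exact QSym.swap23 (c0 ha.ne) hp0 (last a c ha hc)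
    · exact last a b ha hb
  · intro a b c ha hb hc
    have : ∀ {a}, SmoothInt (p + 1) a → SmoothInt p a := fun h => ⟨h.1, fun q hq hd => by
      rcases Nat.lt_succ_iff_lt_or_eq.mp (h.2 q hq hd) with h | rfl
      · exact h
      · exact absurd hq hp⟩
    exact hL a b c (this ha) (this hb) (this hc)

theorem qlevel (n : ℕ) : QLevel n := by
  induction n with
  | zero =>
    apply qlevel_of_gen
    have : ∀ a, GenInt 0 a → ¬ 0 < a := by
      rintro a (rfl | ⟨q, _, h, _⟩)
      · simp
      · omega
    intro a b c ha hb hc h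
    have h1 := this a ha
    have h2 := this b hb
    have h3 := this c hc
    tauto
  | succ n ih => exact qlevel_succ ih

theorem qsym_int (a b c : ℤ) (ha : a ≠ 0) (hb : b ≠ 0) (hc : c ≠ 0)
    (h : 0 < a ∨ 0 < b ∨ 0 < c) : QSym a b c := by
  apply qlevel (a.natAbs + b.natAbs + c.natAbs + 1) a b c _ _ _ h <;>
  exact SmoothInt.of_lt ‹_› (by
    have h1 := abs_nonneg a
    have h2 := abs_nonneg b
    have h3 := abs_nonneg c
    push_cast; omega)

theorem qsym_rat (a b c : ℚ) (ha : a ≠ 0) (hb : b ≠ 0) (hc : c ≠ 0)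
    (h : 0 < a ∨ 0 < b ∨ 0 < c) : QSym a b c := by
  have key : ∀ a : ℚ, a ≠ 0 → ∃ n : ℤ, ∃ t : ℚ, n ≠ 0 ∧ t ≠ 0 ∧ (n : ℚ) = a * t ^ 2 := by
    intro a ha
    refine ⟨a.num * a.den, a.den, ?_, ?_, ?_⟩
    · exact mul_ne_zero (by simpa using ha) (by simp)
    · simp
    · push_cast
      rw [← Rat.mul_den_eq_num a]; ring
  have sg : ∀ {a t : ℚ} {n : ℤ}, t ≠ 0 → (n : ℚ) = a * t ^ 2 → 0 < a → 0 < n := by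
    intro a t n ht e h
    have : (0 : ℚ) < n := by rw [e]; positivity
    exact_mod_cast this
  obtain ⟨n, t, hn, ht, e⟩ := key a ha
  obtain ⟨n', t', hn', ht', e'⟩ := key b hb
  obtain ⟨n'', t'', hn'', ht'', e''⟩ := key c hc
  have := qsym_int n n' n'' hn hn' hn'' (by
    rcases h with h | h | h
    · exact Or.inl (sg ht e h)
    · exact Or.inr (Or.inl (sg ht' e' h))
    · exact Or.inr (Or.inr (sg ht'' e'' h)))
  rw [e, e', e''] at this
  obtain ⟨x, y, z, w, h⟩ := this
  refine ⟨x / t'', y * t / t'', z * t' / t'', w * t * t' / t'', ?_⟩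
  field_simp
  linear_combination h

theorem quad_aux (ℓ : Type*) [Field ℓ] [Algebra ℚ ℓ] (hdeg : Module.finrank ℚ ℓ = 2)
    (himag : IsEmpty (ℓ →+* ℝ)) (σ : ℓ ≃ₐ[ℚ] ℓ) (hσ : σ ≠ AlgEquiv.refl)
    (hinv : ∀ x, σ (σ x) = x) :
    (∀ x, σ x = x → ∃ r : ℚ, x = algebraMap ℚ ℓ r) ∧
    ∃ (θ : ℓ) (d : ℚ), 0 < d ∧ σ θ = -θ ∧ θ * θ = algebraMap ℚ ℓ (-d) ∧
      ∀ x, ∃ r s : ℚ, x = algebraMap ℚ ℓ r + algebraMap ℚ ℓ s * θ := by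
  have : FiniteDimensional ℚ ℓ := Module.finite_of_finrank_pos (by omega)
  have : CharZero ℓ := algebraRat.charZero ℓ
  obtain ⟨x0, hx0⟩ : ∃ x, σ x ≠ x := by
    by_contra! hc
    exact hσ (AlgEquiv.ext hc)
  have hfix : ∀ x, σ x = x → ∃ r : ℚ, x = algebraMap ℚ ℓ r := by
    let K : Submodule ℚ ℓ := LinearMap.eqLocus σ.toLinearMap LinearMap.id
    have hK : ∀ x, x ∈ K ↔ σ x = x := fun x => Iff.rfl
    have hlt : Module.finrank ℚ K < 2 := by
      rw [← hdeg]
      apply Submodule.finrank_lt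
      intro h
      exact hx0 ((hK x0).mp (h ▸ Submodule.mem_top))
    have h1 : (1 : ℓ) ∈ K := (hK 1).mpr (map_one σ)
    have h10 : (⟨1, h1⟩ : K) ≠ 0 := by
      intro h; exact one_ne_zero (congrArg Subtype.val h)
    have hone : Module.finrank ℚ K = 1 := by
      have : 0 < Module.finrank ℚ K := by
        have : Nontrivial K := ⟨⟨_, _, h10⟩⟩
        exact Module.finrank_pos
      omega
    rw [finrank_eq_one_iff_of_nonzero' _ h10] at hone
    intro x hx
    obtain ⟨c, hc⟩ := hone ⟨x, hx⟩
    refine ⟨c, ?_⟩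
    have : c • (1 : ℓ) = x := congrArg Subtype.val hc
    rw [← this]
    simp [Algebra.smul_def]
  refine ⟨hfix, ?_⟩
  set θ := x0 - σ x0 with hθ
  have hθ0 : θ ≠ 0 := sub_ne_zero.mpr hx0.symm
  have hσθ : σ θ = -θ := by rw [hθ, map_sub, hinv]; ring
  obtain ⟨e, he⟩ := hfix (θ * θ) (by rw [map_mul, hσθ]; ring)
  have hrep : ∀ x, ∃ r s : ℚ, x = algebraMap ℚ ℓ r + algebraMap ℚ ℓ s * θ := by
    intro x
    obtain ⟨r, hr⟩ := hfix ((x + σ x) / 2) (by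
      rw [map_div₀, map_add, hinv, map_ofNat, add_comm])
    obtain ⟨s, hs⟩ := hfix ((x - σ x) / 2 / θ) (by
      rw [map_div₀, map_div₀, map_sub, hinv, map_ofNat, hσθ]; field_simp; ring)
    refine ⟨r, s, ?_⟩
    rw [← hr, ← hs]; field_simp; ring
  have he0 : e ≠ 0 := by
    rintro rfl
    rw [map_zero] at he
    exact hθ0 (mul_self_eq_zero.mp he)
  have hneg : e < 0 := by
    by_contra hc
    have hpos : 0 < e := lt_of_le_of_ne (not_lt.mp hc) he0.symm
    let φ : ℓ →ₐ[ℚ] ℂ := IsAlgClosed.lift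
    have hφ : φ θ * φ θ = (e : ℂ) := by
      rw [← map_mul, he, AlgHom.commutes]; simp
    have hposR : (0 : ℝ) ≤ (e : ℝ) := by exact_mod_cast hpos.le
    have hφ' : φ θ * φ θ = ((Real.sqrt e : ℝ) : ℂ) * ((Real.sqrt e : ℝ) : ℂ) := by
      rw [hφ, ← Complex.ofReal_mul, Real.mul_self_sqrt hposR]; simp
    have hreal : (starRingEnd ℂ) (φ θ) = φ θ := by
      rcases mul_self_eq_mul_self_iff.mp hφ' with h | h <;> rw [h] <;> simp
    have hR : NumberField.ComplexEmbedding.IsReal (φ : ℓ →+* ℂ) := by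
      rw [NumberField.ComplexEmbedding.isReal_iff]
      ext x
      obtain ⟨r, s, rfl⟩ := hrep x
      simp [NumberField.ComplexEmbedding.conjugate_coe_eq, hreal]
    exact himag.false hR.embedding
  exact ⟨θ, -e, by linarith, hσθ, by rw [he, neg_neg], hrep⟩


/-- Let `ℓ` be an imaginary quadratic number field (a degree-2 extension of `ℚ` with no
real embeddings) with nontrivial `ℚ`-automorphism `σ`, let `n ≥ 3`, and let
`h : ℓⁿ × ℓⁿ → ℓ` be a hermitian form: additive in each variable, `ℓ`-linear in the first
variable, `σ`-semilinear in the second variable, with `h(w,v) = σ(h(v,w))`. If `h` is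
indefinite (it takes both a positive rational and a negative rational value on the
diagonal), then `h` is isotropic: there is `u ≠ 0` with `h(u,u) = 0`. -/
theorem stmt_19 (ℓ : Type*) [Field ℓ] [Algebra ℚ ℓ] (hdeg : Module.finrank ℚ ℓ = 2)
    (himag : IsEmpty (ℓ →+* ℝ))
    (σ : ℓ ≃ₐ[ℚ] ℓ) (hσ : σ ≠ AlgEquiv.refl)
    (n : ℕ) (hn : 3 ≤ n)
    (h : (Fin n → ℓ) → (Fin n → ℓ) → ℓ)
    (hadd₁ : ∀ v₁ v₂ w, h (v₁ + v₂) w = h v₁ w + h v₂ w)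
    (hadd₂ : ∀ v w₁ w₂, h v (w₁ + w₂) = h v w₁ + h v w₂)
    (hsmul₁ : ∀ (c : ℓ) v w, h (c • v) w = c * h v w)
    (hsmul₂ : ∀ (c : ℓ) v w, h v (c • w) = σ c * h v w)
    (hsymm : ∀ v w, h w v = σ (h v w))
    (hindef : ∃ v w : Fin n → ℓ,
      (∃ p : ℚ, 0 < p ∧ h v v = algebraMap ℚ ℓ p) ∧
      (∃ q : ℚ, q < 0 ∧ h w w = algebraMap ℚ ℓ q)) :
    ∃ u : Fin n → ℓ, u ≠ 0 ∧ h u u = 0 := by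
  obtain ⟨v, w, ⟨p, hp, hv⟩, ⟨q, hq, hw⟩⟩ := hindef
  have hch : CharZero ℓ := algebraRat.charZero ℓ
  have am0 : ∀ {r : ℚ}, r ≠ 0 → algebraMap ℚ ℓ r ≠ 0 := fun hr => by simpa using hr
  have hp0 := am0 hp.ne'
  have hinv : ∀ x, σ (σ x) = x := by
    intro x
    have h1 := hsymm v (x • v)
    rw [hsmul₁, hsmul₂, map_mul, hv, AlgEquiv.commutes] at h1
    exact (mul_right_cancel₀ hp0 h1).symm
  obtain ⟨hfix, θ, d, hd, hσθ, hθ, hrep⟩ := quad_aux ℓ hdeg himag σ hσ hinv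
  have hnorm : ∀ r s : ℚ, (algebraMap ℚ ℓ r + algebraMap ℚ ℓ s * θ) *
      σ (algebraMap ℚ ℓ r + algebraMap ℚ ℓ s * θ) = algebraMap ℚ ℓ (r ^ 2 + d * s ^ 2) := by
    intro r s
    rw [map_add, map_mul, AlgEquiv.commutes, AlgEquiv.commutes, hσθ]
    have : θ * θ = -algebraMap ℚ ℓ d := by rw [hθ, map_neg]
    simp only [map_add, map_mul, map_pow]
    linear_combination (-(algebraMap ℚ ℓ s) ^ 2) * this
  obtain ⟨w', b, hb, hw'v, hw'⟩ : ∃ (w' : Fin n → ℓ) (b : ℚ), b < 0 ∧ h w' v = 0 ∧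
      h w' w' = algebraMap ℚ ℓ b := by
    set k := h w v / algebraMap ℚ ℓ p with hk
    obtain ⟨r, s, hrs⟩ := hrep (h w v)
    have hN := hnorm r s
    rw [← hrs] at hN
    have h1 : h (w + (-k) • v) v = 0 := by
      rw [hadd₁, hsmul₁, hv, hk]; field_simp; ring
    refine ⟨w + (-k) • v, q - (r ^ 2 + d * s ^ 2) / p, ?_, h1, ?_⟩
    · have : 0 ≤ (r ^ 2 + d * s ^ 2) / p := by positivity
      linarith
    · rw [hadd₂, hsmul₂, h1, hadd₁, hsmul₁, hw, hsymm w v, map_sub, map_div₀, ← hN, hk]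
      field_simp; ring
  have hb0 := am0 hb.ne
  have hvw' : h v w' = 0 := by rw [hsymm w' v, hw'v, map_zero]
  obtain ⟨u0, hu0⟩ : ∃ u0 : Fin n → ℓ, u0 ∉ Submodule.span ℓ {v, w'} := by
    by_contra! hc
    have htop : Submodule.span ℓ {v, w'} = ⊤ := by
      rw [eq_top_iff]; intro x _; exact hc x
    have h1 : Module.finrank ℓ (Submodule.span ℓ ({v, w'} : Set (Fin n → ℓ))) ≤ 2 := by
      classical
      have h2 := finrank_span_finset_le_card (R := ℓ) ({v, w'} : Finset (Fin n → ℓ))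
      have h3 : ({v, w'} : Finset (Fin n → ℓ)).card ≤ 2 := Finset.card_le_two
      have h4 : ((({v, w'} : Finset (Fin n → ℓ))) : Set (Fin n → ℓ)) = {v, w'} := by simp
      rw [Set.finrank, h4] at h2
      omega
    rw [htop, finrank_top, Module.finrank_fin_fun] at h1
    omega
  obtain ⟨u, hu, huv, huw⟩ : ∃ u : Fin n → ℓ, u ≠ 0 ∧ h u v = 0 ∧ h u w' = 0 := by
    refine ⟨u0 + (-(h u0 v / algebraMap ℚ ℓ p)) • v + (-(h u0 w' / algebraMap ℚ ℓ b)) • w',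
      ?_, ?_, ?_⟩
    · intro h0
      apply hu0
      rw [Submodule.mem_span_pair]
      refine ⟨h u0 v / algebraMap ℚ ℓ p, h u0 w' / algebraMap ℚ ℓ b, ?_⟩
      rw [neg_smul, neg_smul] at h0
      rw [← sub_eq_zero, ← neg_eq_zero, ← h0]
      abel
    · rw [hadd₁, hadd₁, hsmul₁, hsmul₁, hv, hw'v]; field_simp; ring
    · rw [hadd₁, hadd₁, hsmul₁, hsmul₁, hw', hvw']; field_simp; ring
  have hvu : h v u = 0 := by rw [hsymm u v, huv, map_zero]
  have hwu : h w' u = 0 := by rw [hsymm u w', huw, map_zero]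
  obtain ⟨c, hc⟩ := hfix (h u u) (hsymm u u).symm
  by_cases hc0 : c = 0
  · exact ⟨u, hu, by rw [hc, hc0, map_zero]⟩
  obtain ⟨x, y, z, t, hx⟩ := qsym_rat (-d) (-p / c) (-b / c) (by linarith)
    (div_ne_zero (by linarith) hc0) (div_ne_zero (by linarith) hc0) (by
      rcases lt_or_gt_of_ne hc0 with h | h
      · exact Or.inr (Or.inl (div_pos_of_neg_of_neg (by linarith) h))
      · exact Or.inr (Or.inr (div_pos (by linarith) h)))
  set X := algebraMap ℚ ℓ z + algebraMap ℚ ℓ t * θ with hX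
  set Z := algebraMap ℚ ℓ x + algebraMap ℚ ℓ y * θ with hZ
  have nX := hnorm z t
  have nZ := hnorm x y
  rw [← hX] at nX
  rw [← hZ] at nZ
  refine ⟨X • v + w' + Z • u, ?_, ?_⟩
  · intro h0
    have h1 : h (X • v + w' + Z • u) w' = algebraMap ℚ ℓ b := by
      rw [hadd₁, hadd₁, hsmul₁, hsmul₁, hvw', huw, hw']; ring
    have h2 : h 0 w' = 0 := by
      have := hsmul₁ 0 0 w'
      simpa using this
    rw [h0, h2] at h1
    exact hb0 h1.symm
  · have h1 : h (X • v + w' + Z • u) (X • v + w' + Z • u) =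
        (X * σ X) * algebraMap ℚ ℓ p + algebraMap ℚ ℓ b + (Z * σ Z) * algebraMap ℚ ℓ c := by
      simp only [hadd₁, hadd₂, hsmul₁, hsmul₂, hv, hw', hc, hvw', hw'v, huv, huw, hvu, hwu]
      ring
    rw [h1, nX, nZ, ← map_mul, ← map_mul, ← map_add, ← map_add]
    have : (z ^ 2 + d * t ^ 2) * p + b + (x ^ 2 + d * y ^ 2) * c = 0 := by
      field_simp at hx
      linear_combination hx
    rw [this, map_zero]
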